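/- Let μ be the uniform probability measure on the standard symmetric generating set {±e_1, …, ±e_d} of ℤ^d, and let Δ_μ f(x) = f(x) - (1/2d) Σ_{i=1}^d (f(x + e_i) + f(x - e_i)). Then the space H^k of μ-harmonic functions f : ℤ^d → ℂ satisfying |f(x)| ≤ C(1 + |x|)^k for some C has dimension C(d+k, d) - C(d+k-2, d), where C(a,b) denotes a binomial coefficient (and C(d+k-2, d) = 0 if k < 2). -/

import Mathlib

open Finset

namespace Lattice

variable {d : ℕ}

/-- Translation by `v`, acting on functions on `ℤ^d`. -/
def shift (v : Fin d → ℤ) : Module.End ℂ ((Fin d → ℤ) → ℂ) :=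
  LinearMap.funLeft ℂ ℂ (fun x => x + v)

@[simp] lemma shift_apply (v : Fin d → ℤ) (f : (Fin d → ℤ) → ℂ) (x : Fin d → ℤ) :
    shift v f x = f (x + v) := rfl

lemma shift_mul_shift (v w : Fin d → ℤ) : shift v * shift w = shift (v + w) := by
  ext f x
  simp [add_assoc]

lemma shift_zero : shift (0 : Fin d → ℤ) = 1 := by
  ext f x
  simp

lemma shift_commute (v w : Fin d → ℤ) : Commute (shift v) (shift w) := by
  rw [Commute, SemiconjBy, shift_mul_shift, shift_mul_shift, add_comm]

/-- The forward difference operator in direction `i`. -/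
def diff (i : Fin d) : Module.End ℂ ((Fin d → ℤ) → ℂ) := shift (Pi.single i 1) - 1

lemma diff_apply (i : Fin d) (f : (Fin d → ℤ) → ℂ) (x : Fin d → ℤ) :
    diff i f x = f (x + Pi.single i 1) - f x := rfl

/-- The functions all of whose iterated differences of order `m` vanish, that is, the
polynomial functions of degree less than `m`. -/
def polyLT (d : ℕ) : ℕ → Submodule ℂ ((Fin d → ℤ) → ℂ)
  | 0 => ⊥
  | m + 1 => ⨅ i, (polyLT d m).comap (diff i)

lemma mem_polyLT_zero {f : (Fin d → ℤ) → ℂ} : f ∈ polyLT d 0 ↔ f = 0 := by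
  simp [polyLT]

lemma mem_polyLT_succ {m : ℕ} {f : (Fin d → ℤ) → ℂ} :
    f ∈ polyLT d (m + 1) ↔ ∀ i, diff i f ∈ polyLT d m := by
  simp [polyLT]

lemma polyLT_le_succ (m : ℕ) : polyLT d m ≤ polyLT d (m + 1) := by
  induction m with
  | zero =>
    intro f hf
    rw [mem_polyLT_zero.1 hf]
    exact zero_mem _
  | succ m ih =>
    intro f hf
    rw [mem_polyLT_succ] at hf ⊢
    exact fun i => ih (hf i)

lemma polyLT_mono : Monotone (polyLT d) := monotone_nat_of_le_succ polyLT_le_succ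

lemma diff_mem_polyLT {m : ℕ} {f : (Fin d → ℤ) → ℂ} (hf : f ∈ polyLT d m) (i : Fin d) :
    diff i f ∈ polyLT d (m - 1) := by
  cases m with
  | zero =>
    rw [mem_polyLT_zero.1 hf, map_zero]
    exact zero_mem _
  | succ m => exact mem_polyLT_succ.1 hf i

lemma map_mem_polyLT_of_commute {A : Module.End ℂ ((Fin d → ℤ) → ℂ)}
    (hA : ∀ i, Commute A (diff i)) {m : ℕ} {f : (Fin d → ℤ) → ℂ} (hf : f ∈ polyLT d m) :
    A f ∈ polyLT d m := by
  induction m generalizing f with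
  | zero =>
    rw [mem_polyLT_zero.1 hf, map_zero]
    exact zero_mem _
  | succ m ih =>
    rw [mem_polyLT_succ] at hf ⊢
    intro i
    rw [← Module.End.mul_apply, ← (hA i).eq, Module.End.mul_apply]
    exact ih (hf i)

lemma shift_commute_diff (v : Fin d → ℤ) (i : Fin d) : Commute (shift v) (diff i) :=
  (shift_commute _ _).sub_right (Commute.one_right _)

lemma shift_mem_polyLT (v : Fin d → ℤ) {m : ℕ} {f : (Fin d → ℤ) → ℂ} (hf : f ∈ polyLT d m) :
    shift v f ∈ polyLT d m :=
  map_mem_polyLT_of_commute (shift_commute_diff v) hf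

/-- The second central difference operator in direction `i`. -/
def diffTwo (i : Fin d) : Module.End ℂ ((Fin d → ℤ) → ℂ) :=
  shift (-Pi.single i 1) * (diff i * diff i)

lemma diffTwo_apply (i : Fin d) (f : (Fin d → ℤ) → ℂ) (x : Fin d → ℤ) :
    diffTwo i f x = f (x + Pi.single i 1) + f (x - Pi.single i 1) - 2 * f x := by
  simp only [diffTwo, Module.End.mul_apply, shift_apply, diff_apply, neg_add_cancel_right,
    sub_eq_add_neg]
  ring

lemma diffTwo_mem_polyLT {m : ℕ} {f : (Fin d → ℤ) → ℂ} (hf : f ∈ polyLT d m) (i : Fin d) :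
    diffTwo i f ∈ polyLT d (m - 2) :=
  shift_mem_polyLT _ (diff_mem_polyLT (diff_mem_polyLT hf i) i)

/-- The (unnormalised) discrete Laplacian. -/
def lap (d : ℕ) : Module.End ℂ ((Fin d → ℤ) → ℂ) := ∑ i, diffTwo i

lemma lap_apply (f : (Fin d → ℤ) → ℂ) (x : Fin d → ℤ) :
    lap d f x = ∑ i, (f (x + Pi.single i 1) + f (x - Pi.single i 1)) - 2 * d * f x := by
  simp [lap, LinearMap.sum_apply, Finset.sum_apply, diffTwo_apply, Finset.sum_sub_distrib]
  ring

lemma lap_commute_diff (i : Fin d) : Commute (lap d) (diff i) := by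
  have h (j : Fin d) : Commute (diff j) (diff i) :=
    (shift_commute_diff _ i).sub_left (Commute.one_left _)
  exact Commute.sum_left _ _ _ fun j _ => (shift_commute_diff _ i).mul_left ((h j).mul_left (h j))

/-! ### Indefinite summation -/

/-- The primitive of `h : ℤ → ℂ` for the forward difference vanishing at `0`. -/
def intPrimitive (h : ℤ → ℂ) : ℤ → ℂ
  | Int.ofNat n => ∑ j ∈ range n, h j
  | Int.negSucc n => -∑ j ∈ range (n + 1), h (-(j + 1 : ℤ))

lemma intPrimitive_add_one_sub (h : ℤ → ℂ) (n : ℤ) :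
    intPrimitive h (n + 1) - intPrimitive h n = h n := by
  match n with
  | Int.ofNat n =>
    change ∑ j ∈ range (n + 1), h j - ∑ j ∈ range n, h j = _
    rw [sum_range_succ, add_sub_cancel_left]
    rfl
  | Int.negSucc 0 => simp [intPrimitive]
  | Int.negSucc (n + 1) =>
    have : Int.negSucc (n + 1) + 1 = Int.negSucc n := by omega
    rw [this]
    change -∑ j ∈ range (n + 1), h (-(j + 1 : ℤ)) - -∑ j ∈ range (n + 1 + 1), h (-(j + 1 : ℤ)) = _
    rw [sum_range_succ _ (n + 1)]
    have : (-(((n + 1 : ℕ) : ℤ) + 1)) = Int.negSucc (n + 1) := by omega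
    rw [this]
    ring

/-- Indefinite summation in direction `i`. -/
def primitive (i : Fin d) : Module.End ℂ ((Fin d → ℤ) → ℂ) where
  toFun f x := intPrimitive (fun j => f (Function.update x i j)) (x i)
  map_add' f g := by
    ext x
    simp only [Pi.add_apply]
    cases x i <;> simp [intPrimitive, sum_add_distrib]; ring
  map_smul' c f := by
    ext x
    simp only [Pi.smul_apply, RingHom.id_apply]
    cases x i <;> simp [intPrimitive, mul_sum]

lemma primitive_apply (i : Fin d) (f : (Fin d → ℤ) → ℂ) (x : Fin d → ℤ) :
    primitive i f x = intPrimitive (fun j => f (Function.update x i j)) (x i) := rfl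

lemma diff_mul_primitive (i : Fin d) : diff i * primitive i = 1 := by
  ext f x
  have h (j : ℤ) : Function.update (x + Pi.single i 1) i j = Function.update x i j := by
    ext l
    rcases eq_or_ne l i with rfl | hl <;> simp [*]
  simp only [Module.End.mul_apply, diff_apply, primitive_apply, h, Pi.add_apply,
    Pi.single_eq_same, intPrimitive_add_one_sub, Function.update_eq_self, Module.End.one_apply]

lemma shift_commute_primitive {i : Fin d} {v : Fin d → ℤ} (hv : v i = 0) :
    Commute (shift v) (primitive i) := by
  ext f x
  have h (j : ℤ) : Function.update (x + v) i j = Function.update x i j + v := by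
    ext l
    rcases eq_or_ne l i with rfl | hl <;> simp [*]
  simp [primitive_apply, h, hv]

lemma diff_commute_primitive {i j : Fin d} (hij : i ≠ j) : Commute (diff j) (primitive i) :=
  (shift_commute_primitive (by simp [hij])).sub_left (Commute.one_left _)

lemma primitive_mem_polyLT (i : Fin d) {m : ℕ} {f : (Fin d → ℤ) → ℂ} (hf : f ∈ polyLT d m) :
    primitive i f ∈ polyLT d (m + 1) := by
  induction m generalizing f with
  | zero =>
    rw [mem_polyLT_zero.1 hf, map_zero]
    exact zero_mem _
  | succ m ih =>
    rw [mem_polyLT_succ]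
    intro j
    rcases eq_or_ne i j with rfl | hij
    · rwa [← Module.End.mul_apply, diff_mul_primitive]
    · rw [← Module.End.mul_apply, (diff_commute_primitive hij).eq, Module.End.mul_apply]
      exact ih (mem_polyLT_succ.1 hf j)

/-! ### The Laplacian is onto -/

lemma sum_diffTwo_pow_eq_zero (s : Finset (Fin d)) {m : ℕ} {f : (Fin d → ℤ) → ℂ}
    (hf : f ∈ polyLT d m) : ((∑ i ∈ s, diffTwo i) ^ m) f = 0 := by
  induction m generalizing f with
  | zero => simpa using mem_polyLT_zero.1 hf
  | succ m ih =>
    rw [pow_succ, Module.End.mul_apply]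
    refine ih ?_
    rw [LinearMap.sum_apply]
    exact sum_mem fun i _ => polyLT_mono (by omega) (diffTwo_mem_polyLT hf i)

lemma exists_lap_eq (i : Fin d) {m : ℕ} {g : (Fin d → ℤ) → ℂ} (hg : g ∈ polyLT d m) :
    ∃ f ∈ polyLT d (m + 2), lap d f = g := by
  set D : Module.End ℂ ((Fin d → ℤ) → ℂ) := ∑ j ∈ univ.erase i, diffTwo j with hD
  set K : Module.End ℂ ((Fin d → ℤ) → ℂ) :=
    primitive i * (primitive i * shift (Pi.single i 1)) with hK
  have hlap : lap d = diffTwo i + D := (add_sum_erase _ _ (mem_univ i)).symm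
  have hDK : Commute D K := by
    refine Commute.sum_left _ _ _ fun j hj => ?_
    have hij : i ≠ j := (ne_of_mem_erase hj).symm
    have h1 : Commute (diffTwo j) (primitive i) :=
      (shift_commute_primitive (by simp [hij])).mul_left
        ((diff_commute_primitive hij).mul_left (diff_commute_primitive hij))
    have h2 : Commute (diffTwo j) (shift (Pi.single i 1)) :=
      (shift_commute _ _).mul_left
        ((shift_commute_diff _ j).symm.mul_left (shift_commute_diff _ j).symm)
    exact h1.mul_right (h1.mul_right h2)
  have hK1 : diffTwo i * K = 1 := by
    calc diffTwo i * K = shift (-Pi.single i 1) * (diff i * (diff i * primitive i) * primitive i *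
          shift (Pi.single i 1)) := by simp only [diffTwo, hK, mul_assoc]
      _ = 1 := by
        rw [diff_mul_primitive, mul_one, diff_mul_primitive, one_mul, shift_mul_shift,
          neg_add_cancel, shift_zero]
  have hKm {h : (Fin d → ℤ) → ℂ} (hh : h ∈ polyLT d m) : K h ∈ polyLT d (m + 2) :=
    primitive_mem_polyLT i (primitive_mem_polyLT i (shift_mem_polyLT _ hh))
  have key (n : ℕ) : ∀ g ∈ polyLT d m, (D ^ n) g = 0 → ∃ f ∈ polyLT d (m + 2), lap d f = g := by
    induction n with
    | zero => exact fun g _ h => ⟨0, zero_mem _, by simpa using h.symm⟩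
    | succ n ih =>
      intro g hg h
      obtain ⟨f, hf, hfg⟩ := ih (-(D (K g))) (by
          rw [hD, LinearMap.sum_apply]
          exact neg_mem (sum_mem fun j _ => diffTwo_mem_polyLT (hKm hg) j)) (by
          rw [map_neg, ← Module.End.mul_apply, ← pow_succ, ← Module.End.mul_apply,
            (hDK.pow_left _).eq, Module.End.mul_apply, h, map_zero, neg_zero])
      refine ⟨K g + f, add_mem (hKm hg) hf, ?_⟩
      rw [map_add, hfg, hlap, LinearMap.add_apply, ← Module.End.mul_apply, hK1]
      simp
  exact key m g hg (sum_diffTwo_pow_eq_zero _ hg)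

lemma map_lap_polyLT (i : Fin d) (k : ℕ) :
    (polyLT d (k + 1)).map (lap d) = polyLT d (k - 1) := by
  apply le_antisymm
  · rintro _ ⟨f, hf, rfl⟩
    rw [lap, LinearMap.sum_apply]
    exact sum_mem fun j _ => diffTwo_mem_polyLT hf j
  · intro g hg
    cases k with
    | zero => exact ⟨0, zero_mem _, by rw [map_zero, mem_polyLT_zero.1 hg]⟩
    | succ k => exact exists_lap_eq i hg

/-! ### The dimension of the space of polynomial functions -/

lemma finrank_map_add_finrank_inf_ker {V : Type*} [AddCommGroup V] [Module ℂ V]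
    (A : Submodule ℂ V) [Module.Finite ℂ A] (φ : Module.End ℂ V) :
    Module.finrank ℂ (A.map φ) + Module.finrank ℂ (A ⊓ φ.ker : Submodule ℂ V) =
      Module.finrank ℂ A := by
  rw [← LinearMap.finrank_range_add_finrank_ker (φ.domRestrict A), LinearMap.range_domRestrict,
    LinearMap.ker_domRestrict]
  have : (LinearMap.ker φ).comap A.subtype = (A ⊓ LinearMap.ker φ).submoduleOf A := by
    ext x
    simp [Submodule.submoduleOf]
  rw [this, (Submodule.submoduleOfEquivOfLe inf_le_left).finrank_eq]

/-- Functions on `ℤ^d`, seen as functions on `ℤ^(d+1)` not depending on the first coordinate. -/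
def compTail (d : ℕ) : ((Fin d → ℤ) → ℂ) →ₗ[ℂ] ((Fin (d + 1) → ℤ) → ℂ) :=
  LinearMap.funLeft ℂ ℂ Fin.tail

@[simp] lemma compTail_apply (f : (Fin d → ℤ) → ℂ) (x : Fin (d + 1) → ℤ) :
    compTail d f x = f (Fin.tail x) := rfl

lemma compTail_injective : Function.Injective (compTail d) := by
  intro f g h
  ext x
  simpa using congrFun h (Fin.cons 0 x)

lemma diff_zero_compTail (f : (Fin d → ℤ) → ℂ) : diff 0 (compTail d f) = 0 := by
  ext x
  have : Fin.tail (x + Pi.single 0 1) = Fin.tail x := by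
    ext j
    simp [Fin.tail]
  simp [diff_apply, this]

lemma diff_succ_compTail (i : Fin d) (f : (Fin d → ℤ) → ℂ) :
    diff i.succ (compTail d f) = compTail d (diff i f) := by
  ext x
  have : Fin.tail (x + Pi.single i.succ 1) = Fin.tail x + Pi.single i 1 := by
    ext j
    simp [Fin.tail, Pi.single_apply]
  simp [diff_apply, this]

lemma compTail_mem_polyLT {m : ℕ} {f : (Fin d → ℤ) → ℂ} :
    compTail d f ∈ polyLT (d + 1) m ↔ f ∈ polyLT d m := by
  induction m generalizing f with
  | zero => rw [mem_polyLT_zero, mem_polyLT_zero, map_eq_zero_iff _ compTail_injective]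
  | succ m ih =>
    simp [mem_polyLT_succ, Fin.forall_fin_succ, diff_zero_compTail, diff_succ_compTail, ih]

lemma exists_compTail_eq {f : (Fin (d + 1) → ℤ) → ℂ} (hf : diff 0 f = 0) :
    ∃ g, compTail d g = f := by
  have hstep (y : Fin d → ℤ) (n : ℤ) : f (Fin.cons (n + 1) y) = f (Fin.cons n y) := by
    have := congrFun hf (Fin.cons n y)
    have h : (Fin.cons n y + Pi.single 0 1 : Fin (d + 1) → ℤ) = Fin.cons (n + 1) y := by
      ext j
      cases j using Fin.cases <;> simp
    rwa [diff_apply, h, Pi.zero_apply, sub_eq_zero] at this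
  have hconst (y : Fin d → ℤ) (n : ℤ) : f (Fin.cons n y) = f (Fin.cons 0 y) := by
    induction n with
    | zero => rfl
    | succ n ih => rw [hstep, ih]
    | pred n ih => rw [← ih, ← hstep, sub_add_cancel]
  refine ⟨fun y => f (Fin.cons 0 y), ?_⟩
  ext x
  rw [compTail_apply, ← hconst _ (x 0), Fin.cons_self_tail]

lemma map_compTail_polyLT (m : ℕ) :
    (polyLT d m).map (compTail d) = polyLT (d + 1) m ⊓ LinearMap.ker (diff 0) := by
  apply le_antisymm
  · rintro _ ⟨f, hf, rfl⟩
    exact ⟨compTail_mem_polyLT.2 hf, diff_zero_compTail f⟩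
  · rintro f ⟨hf, hf0⟩
    obtain ⟨g, rfl⟩ := exists_compTail_eq hf0
    exact ⟨g, compTail_mem_polyLT.1 hf, rfl⟩

lemma map_diff_polyLT (i : Fin d) (m : ℕ) : (polyLT d (m + 1)).map (diff i) = polyLT d m := by
  apply le_antisymm
  · rintro _ ⟨f, hf, rfl⟩
    exact mem_polyLT_succ.1 hf i
  · intro g hg
    refine ⟨primitive i g, primitive_mem_polyLT i hg, ?_⟩
    rw [← Module.End.mul_apply, diff_mul_primitive, Module.End.one_apply]

lemma polyLT_zero_succ (m : ℕ) : polyLT 0 (m + 1) = ⊤ := by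
  simp [polyLT]

lemma polyLT_fg (d m : ℕ) : (polyLT d m).FG := by
  induction d generalizing m with
  | zero => exact IsNoetherian.noetherian _
  | succ d ihd =>
    induction m with
    | zero => exact Submodule.fg_bot
    | succ m ihm =>
      refine Submodule.fg_of_fg_map_of_fg_inf_ker (diff 0) ?_ ?_
      · rwa [map_diff_polyLT]
      · rw [← map_compTail_polyLT]
        exact (ihd _).map _

instance (d m : ℕ) : Module.Finite ℂ (polyLT d m) := Module.Finite.iff_fg.2 (polyLT_fg d m)

lemma finrank_polyLT_zero (d : ℕ) : Module.finrank ℂ (polyLT d 0) = 0 :=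
  finrank_bot ℂ _

lemma finrank_polyLT_succ (d m : ℕ) :
    Module.finrank ℂ (polyLT d (m + 1)) = (d + m).choose d := by
  induction d generalizing m with
  | zero =>
    rw [polyLT_zero_succ, finrank_top]
    simp
  | succ d ihd =>
    have h (m : ℕ) : Module.finrank ℂ (polyLT (d + 1) m) +
        Module.finrank ℂ ((polyLT d (m + 1)).map (compTail d)) =
        Module.finrank ℂ (polyLT (d + 1) (m + 1)) := by
      rw [← finrank_map_add_finrank_inf_ker (polyLT (d + 1) (m + 1)) (diff 0), map_diff_polyLT,
        map_compTail_polyLT]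
    have h' (m : ℕ) : Module.finrank ℂ ((polyLT d (m + 1)).map (compTail d)) =
        (d + m).choose d := by
      rw [← ihd, ← (Submodule.equivMapOfInjective _ compTail_injective _).finrank_eq]
    induction m with
    | zero => rw [← h, h', finrank_polyLT_zero]; simp
    | succ m ihm =>
      rw [← h, h', ihm, show d + 1 + (m + 1) = (d + 1 + m) + 1 by ring, Nat.choose_succ_succ,
        show d + (m + 1) = d + 1 + m by ring, add_comm]

/-! ### Gradient estimate -/

/-- The squared Euclidean norm of a lattice point. -/
def sqNorm (x : Fin d → ℤ) : ℝ := ∑ i, (x i : ℝ) ^ 2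

lemma sqNorm_nonneg (x : Fin d → ℤ) : 0 ≤ sqNorm x := sum_nonneg fun _ _ => sq_nonneg _

lemma sq_le_sqNorm (x : Fin d → ℤ) (i : Fin d) : (x i : ℝ) ^ 2 ≤ sqNorm x :=
  single_le_sum (f := fun i => (x i : ℝ) ^ 2) (fun _ _ => sq_nonneg _) (mem_univ i)

lemma sqNorm_add_single (x : Fin d → ℤ) (i : Fin d) :
    sqNorm (x + Pi.single i 1) = sqNorm x + 1 + 2 * x i := by
  have h (j : Fin d) : (((x + Pi.single i 1 : Fin d → ℤ) j : ℤ) : ℝ) ^ 2 =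
      (x j : ℝ) ^ 2 + if j = i then 1 + 2 * (x j : ℝ) else 0 := by
    rcases eq_or_ne j i with rfl | hj
    · simp; ring
    · simp [hj]
  simp only [sqNorm, h, sum_add_distrib, sum_ite_eq', mem_univ, if_true]
  ring

lemma sqNorm_sub_single (x : Fin d → ℤ) (i : Fin d) :
    sqNorm (x - Pi.single i 1) = sqNorm x + 1 - 2 * x i := by
  have := sqNorm_add_single (x - Pi.single i 1) i
  simp only [sub_add_cancel, Pi.sub_apply, Pi.single_eq_same] at this
  push_cast at this
  linarith

lemma add_pow_add_sub_pow_le {a b : ℝ} (ha : 0 ≤ a) (hb : b ^ 2 ≤ 4 * a) (k : ℕ) :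
    (a + b) ^ k + (a - b) ^ k ≤ 2 * (a + 4 * k) ^ k := by
  have key (j : ℕ) (hj : j ≤ k) : (a + b) ^ j + (a - b) ^ j ≤ 2 * (a + 4 * k) ^ j ∧
      b * ((a + b) ^ j - (a - b) ^ j) ≤ 8 * j * (a + 4 * k) ^ j := by
    induction j with
    | zero => norm_num
    | succ j ih =>
      obtain ⟨h1, h2⟩ := ih (by omega)
      have hjk : (j : ℝ) ≤ k := by exact_mod_cast (by omega : j ≤ k)
      have hX : 0 ≤ (a + 4 * k) ^ j := by positivity
      have hk : (0 : ℝ) ≤ k := by positivity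
      have hj0 : (0 : ℝ) ≤ j := by positivity
      simp only [pow_succ _ j]
      push_cast
      constructor
      · nlinarith [mul_le_mul_of_nonneg_left h1 ha, mul_le_mul_of_nonneg_right hjk hX]
      · have h3 := mul_le_mul_of_nonneg_left h1 (sq_nonneg b)
        have h4 := mul_le_mul_of_nonneg_right hb hX
        have h5 := mul_le_mul_of_nonneg_left h2 ha
        have h6 : 0 ≤ (j + 1 : ℝ) * (k * (a + 4 * k) ^ j) := by positivity
        nlinarith
  exact (key k le_rfl).1

lemma sum_neighbors_pow_le {n : ℝ} (hn : 0 ≤ n) (k : ℕ) (x : Fin d → ℤ) :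
    ∑ i, ((n + sqNorm (x + Pi.single i 1)) ^ k + (n + sqNorm (x - Pi.single i 1)) ^ k) ≤
      2 * d * (n + (4 * k + 1) + sqNorm x) ^ k := by
  have h (i : Fin d) : (n + sqNorm (x + Pi.single i 1)) ^ k +
      (n + sqNorm (x - Pi.single i 1)) ^ k ≤ 2 * (n + (4 * k + 1) + sqNorm x) ^ k := by
    have h0 := sqNorm_nonneg x
    have := add_pow_add_sub_pow_le (a := n + sqNorm x + 1) (b := 2 * x i) (by linarith)
      (by linarith [sq_le_sqNorm x i]) k
    rw [sqNorm_add_single, sqNorm_sub_single]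
    convert this using 2 <;> ring
  refine (sum_le_sum fun i _ => h i).trans (le_of_eq ?_)
  rw [sum_const, card_univ, Fintype.card_fin, nsmul_eq_mul]
  ring

/-- If `v` is subharmonic and bounded by the Laplacian of `u`, then a polynomial bound on `u`
gives a better bound on `v`. -/
lemma mul_subharmonic_add_le (hd : 1 ≤ d) {u v : (Fin d → ℤ) → ℝ}
    (hv : ∀ x, 2 * d * v x ≤ ∑ i, (v (x + Pi.single i 1) + v (x - Pi.single i 1)))
    (huv : ∀ x, v x + 2 * d * u x ≤ ∑ i, (u (x + Pi.single i 1) + u (x - Pi.single i 1)))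
    {c n : ℝ} {k : ℕ} (hc : 0 ≤ c) (hn : 0 ≤ n) (hu : ∀ x, u x ≤ c * (n + sqNorm x) ^ k) (N : ℕ)
    (x : Fin d → ℤ) :
    N * v x + 2 * d * u x ≤ 2 * d * c * (n + N * (4 * k + 1) + sqNorm x) ^ k := by
  have hd0 : (0 : ℝ) < 2 * d := by positivity
  induction N generalizing x with
  | zero =>
    have := mul_le_mul_of_nonneg_left (hu x) hd0.le
    simpa [mul_assoc] using this
  | succ N ih =>
    have h1 := sum_le_sum fun i (_ : i ∈ univ) =>
      add_le_add (ih (x + Pi.single i 1)) (ih (x - Pi.single i 1))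
    have h2 : ∑ i, ((N * v (x + Pi.single i 1) + 2 * d * u (x + Pi.single i 1)) +
        (N * v (x - Pi.single i 1) + 2 * d * u (x - Pi.single i 1))) =
        N * ∑ i, (v (x + Pi.single i 1) + v (x - Pi.single i 1)) +
        2 * d * ∑ i, (u (x + Pi.single i 1) + u (x - Pi.single i 1)) := by
      rw [mul_sum, mul_sum, ← sum_add_distrib]
      exact sum_congr rfl fun _ _ => by ring
    simp only [← mul_add (2 * d * c), ← mul_sum] at h1
    have h3 := mul_le_mul_of_nonneg_left (sum_neighbors_pow_le
      (n := n + N * (4 * k + 1)) (by positivity) k x) (mul_nonneg hd0.le hc)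
    have h4 := mul_le_mul_of_nonneg_left (hv x) (Nat.cast_nonneg (α := ℝ) N)
    have h5 := mul_le_mul_of_nonneg_left (huv x) hd0.le
    rw [h2] at h1
    refine le_of_mul_le_mul_left ?_ hd0
    have h6 : n + N * (4 * k + 1) + (4 * k + 1) + sqNorm x =
        n + (N + 1 : ℕ) * (4 * k + 1) + sqNorm x := by
      push_cast
      ring
    rw [h6] at h3
    push_cast at h3 ⊢
    linarith

lemma sum_normSq_neighbors {f : (Fin d → ℤ) → ℂ} (hf : lap d f = 0) (x : Fin d → ℤ) :
    ∑ i, (Complex.normSq (f (x + Pi.single i 1)) + Complex.normSq (f (x - Pi.single i 1))) =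
      ∑ i, (Complex.normSq (f (x + Pi.single i 1) - f x) +
        Complex.normSq (f (x - Pi.single i 1) - f x)) + 2 * d * Complex.normSq (f x) := by
  have h := congrFun hf x
  rw [lap_apply, Pi.zero_apply, sub_eq_zero] at h
  have hre := congrArg Complex.re h
  have him := congrArg Complex.im h
  simp only [Complex.re_sum, Complex.im_sum, Complex.add_re, Complex.add_im] at hre him
  have hcast : (2 * d : ℂ) * f x = ((2 * d : ℝ) : ℂ) * f x := by push_cast; rfl
  rw [hcast, Complex.re_ofReal_mul] at hre
  rw [hcast, Complex.im_ofReal_mul] at him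
  have hterm (i : Fin d) : Complex.normSq (f (x + Pi.single i 1) - f x) +
      Complex.normSq (f (x - Pi.single i 1) - f x) =
      (Complex.normSq (f (x + Pi.single i 1)) + Complex.normSq (f (x - Pi.single i 1))) +
      2 * Complex.normSq (f x) -
      2 * (f x).re * ((f (x + Pi.single i 1)).re + (f (x - Pi.single i 1)).re) -
      2 * (f x).im * ((f (x + Pi.single i 1)).im + (f (x - Pi.single i 1)).im) := by
    simp only [Complex.normSq_apply, Complex.sub_re, Complex.sub_im]
    ring
  simp only [hterm]
  rw [sum_sub_distrib, sum_sub_distrib, ← mul_sum, ← mul_sum, hre, him,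
    sum_add_distrib (g := fun _ => 2 * _), sum_const, card_univ, Fintype.card_fin, nsmul_eq_mul, Complex.normSq_apply (f x)]
  ring

lemma normSq_diff_add_le {f : (Fin d → ℤ) → ℂ} (hf : lap d f = 0) (i : Fin d) (x : Fin d → ℤ) :
    Complex.normSq (diff i f x) + 2 * d * Complex.normSq (f x) ≤
      ∑ i, (Complex.normSq (f (x + Pi.single i 1)) + Complex.normSq (f (x - Pi.single i 1))) := by
  rw [sum_normSq_neighbors hf, diff_apply]
  gcongr
  refine le_trans ?_ (single_le_sum (f := fun i => Complex.normSq (f (x + Pi.single i 1) - f x) +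
    Complex.normSq (f (x - Pi.single i 1) - f x))
    (fun _ _ => add_nonneg (Complex.normSq_nonneg _) (Complex.normSq_nonneg _)) (mem_univ i))
  exact le_add_of_nonneg_right (Complex.normSq_nonneg _)

lemma mul_normSq_le {f : (Fin d → ℤ) → ℂ} (hf : lap d f = 0) (x : Fin d → ℤ) :
    2 * d * Complex.normSq (f x) ≤
      ∑ i, (Complex.normSq (f (x + Pi.single i 1)) + Complex.normSq (f (x - Pi.single i 1))) := by
  rw [sum_normSq_neighbors hf]
  exact le_add_of_nonneg_left (sum_nonneg fun _ _ =>
    add_nonneg (Complex.normSq_nonneg _) (Complex.normSq_nonneg _))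

lemma lap_diff_eq_zero {f : (Fin d → ℤ) → ℂ} (hf : lap d f = 0) (i : Fin d) :
    lap d (diff i f) = 0 := by
  rw [← Module.End.mul_apply, (lap_commute_diff i).eq, Module.End.mul_apply, hf, map_zero]

/-- Every difference of a harmonic function gains a factor `N` in the scaled bound. -/
lemma exists_normSq_diff_le (hd : 1 ≤ d) {f : (Fin d → ℤ) → ℂ} (hf : lap d f = 0) {k m : ℕ}
    (h : ∃ C : ℝ, 0 ≤ C ∧ ∀ N : ℕ, 1 ≤ N → ∀ x,
      N ^ m * Complex.normSq (f x) ≤ C * (N + sqNorm x) ^ k) (i : Fin d) :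
    ∃ C : ℝ, 0 ≤ C ∧ ∀ N : ℕ, 1 ≤ N → ∀ x,
      N ^ (m + 1) * Complex.normSq (diff i f x) ≤ C * (N + sqNorm x) ^ k := by
  obtain ⟨C, hC, h⟩ := h
  refine ⟨2 * d * C * (4 * k + 2) ^ k, by positivity, fun N hN x => ?_⟩
  have hN0 : (0 : ℝ) < N ^ m := by positivity
  have hx := sqNorm_nonneg x
  have key := mul_subharmonic_add_le hd (v := fun x => Complex.normSq (diff i f x))
    (u := fun x => Complex.normSq (f x)) (mul_normSq_le (lap_diff_eq_zero hf i))
    (normSq_diff_add_le hf i) (c := C / N ^ m) (n := N) (k := k) (by positivity) (by positivity)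
    (fun x => by
      rw [div_mul_eq_mul_div, le_div_iff₀ hN0, mul_comm]
      exact h N hN x) N x
  have h1 : (N : ℝ) * Complex.normSq (diff i f x) ≤
      2 * d * (C / N ^ m) * (N + N * (4 * k + 1) + sqNorm x) ^ k :=
    le_trans (le_add_of_nonneg_right (mul_nonneg (by positivity) (Complex.normSq_nonneg _))) key
  have h2 : ((N : ℝ) + N * (4 * k + 1) + sqNorm x) ^ k ≤ (4 * k + 2) ^ k * (N + sqNorm x) ^ k := by
    rw [← mul_pow]
    have : (0 : ℝ) ≤ k * sqNorm x := by positivity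
    exact pow_le_pow_left₀ (by positivity) (by linarith) _
  calc (N : ℝ) ^ (m + 1) * Complex.normSq (diff i f x)
      = N ^ m * (N * Complex.normSq (diff i f x)) := by ring
    _ ≤ N ^ m * (2 * d * (C / N ^ m) * ((4 * k + 2) ^ k * (N + sqNorm x) ^ k)) := by
      exact mul_le_mul_of_nonneg_left (h1.trans (mul_le_mul_of_nonneg_left h2 (by positivity))) hN0.le
    _ = 2 * d * C * (4 * k + 2) ^ k * (N + sqNorm x) ^ k := by field_simp

lemma mem_polyLT_of_normSq_le (hd : 1 ≤ d) {f : (Fin d → ℤ) → ℂ} (hf : lap d f = 0) {k m j : ℕ}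
    (hmj : m + j = k + 1) (h : ∃ C : ℝ, 0 ≤ C ∧ ∀ N : ℕ, 1 ≤ N → ∀ x,
      N ^ m * Complex.normSq (f x) ≤ C * (N + sqNorm x) ^ k) :
    f ∈ polyLT d j := by
  induction j generalizing f m with
  | zero =>
    obtain ⟨C, hC, h⟩ := h
    obtain rfl : m = k + 1 := hmj
    rw [mem_polyLT_zero]
    ext x
    by_contra hfx
    have hpos : 0 < Complex.normSq (f x) := Complex.normSq_pos.2 hfx
    obtain ⟨N, hN⟩ := exists_nat_gt (C * (1 + sqNorm x) ^ k / Complex.normSq (f x))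
    have hx := sqNorm_nonneg x
    rw [div_lt_iff₀ hpos] at hN
    have hN1 : 1 ≤ N := by
      by_contra hN0
      obtain rfl : N = 0 := by omega
      have : 0 ≤ C * (1 + sqNorm x) ^ k := by positivity
      simp at hN
      linarith
    have hN1' : (1 : ℝ) ≤ N := by exact_mod_cast hN1
    have h1 : ((N : ℝ) + sqNorm x) ^ k ≤ N ^ k * (1 + sqNorm x) ^ k := by
      rw [← mul_pow]
      exact pow_le_pow_left₀ (by positivity) (by nlinarith) _
    have h2 := (h N hN1 x).trans (mul_le_mul_of_nonneg_left h1 hC)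
    have h3 : (N : ℝ) ^ k * (N * Complex.normSq (f x)) ≤ N ^ k * (C * (1 + sqNorm x) ^ k) := by
      calc _ = (N : ℝ) ^ (k + 1) * Complex.normSq (f x) := by ring
        _ ≤ _ := h2
        _ = _ := by ring
    exact absurd (le_of_mul_le_mul_left h3 (by positivity)) (not_le.2 hN)
  | succ j ih =>
    rw [mem_polyLT_succ]
    exact fun i => ih (lap_diff_eq_zero hf i) (m := m + 1) (by omega)
      (exists_normSq_diff_le hd hf h i)

/-- A Liouville theorem: harmonic functions of polynomial growth are polynomial. -/
lemma mem_polyLT_of_growth (hd : 1 ≤ d) {f : (Fin d → ℤ) → ℂ} (hf : lap d f = 0) {k : ℕ} {C : ℝ}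
    (h : ∀ x, ‖f x‖ ≤ C * (1 + ((∑ i, (x i).natAbs : ℕ) : ℝ)) ^ k) :
    f ∈ polyLT d (k + 1) := by
  refine mem_polyLT_of_normSq_le hd hf (m := 0) (zero_add _)
    ⟨C ^ 2 * (2 * (d + 1)) ^ k, by positivity, fun N hN x => ?_⟩
  have hx := sqNorm_nonneg x
  have hN' : (1 : ℝ) ≤ N := by exact_mod_cast hN
  set s : ℝ := ((∑ i, (x i).natAbs : ℕ) : ℝ) with hs
  have h1 : s ^ 2 ≤ d * sqNorm x := by
    have := sq_sum_le_card_mul_sum_sq (s := univ) (f := fun i => ((x i).natAbs : ℝ))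
    simpa [hs, sqNorm, Nat.cast_natAbs] using this
  have h2 : (1 + s) ^ 2 ≤ 2 * (d + 1) * (N + sqNorm x) := by
    have hdN : (0 : ℝ) ≤ d * N := by positivity
    nlinarith [sq_nonneg (1 - s)]
  rw [pow_zero, one_mul, Complex.normSq_eq_norm_sq]
  calc ‖f x‖ ^ 2 ≤ (C * (1 + s) ^ k) ^ 2 := pow_le_pow_left₀ (norm_nonneg _) (h x) 2
    _ = C ^ 2 * ((1 + s) ^ 2) ^ k := by rw [mul_pow, pow_right_comm]
    _ ≤ C ^ 2 * (2 * (d + 1) * (N + sqNorm x)) ^ k := by gcongr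
    _ = _ := by rw [mul_pow _ (_ + _ : ℝ)]; ring

/-! ### Growth of polynomial functions -/

lemma norm_le_of_norm_diff_le {f : (Fin d → ℤ) → ℂ} {R : ℕ} {B : ℝ}
    (h : ∀ i y, ∑ j, (y j).natAbs ≤ R → ‖diff i f y‖ ≤ B) (x : Fin d → ℤ)
    (hx : ∑ j, (x j).natAbs ≤ R) : ‖f x‖ ≤ ‖f 0‖ + (∑ j, (x j).natAbs : ℕ) * B := by
  induction hn : ∑ j, (x j).natAbs generalizing x with
  | zero =>
    have : x = 0 := by
      ext j
      simpa using (sum_eq_zero_iff.1 hn) j (mem_univ j)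
    simp [this]
  | succ n ih =>
    obtain ⟨i, -, hi⟩ : ∃ i ∈ univ, (x i).natAbs ≠ 0 := by
      by_contra! h0
      rw [sum_eq_zero h0] at hn
      omega
    have hsum (y : Fin d → ℤ) (hyi : (y i).natAbs + 1 = (x i).natAbs)
        (hy : ∀ j, j ≠ i → y j = x j) : ∑ j, (y j).natAbs = n := by
      rw [← add_sum_erase _ _ (mem_univ i)] at hn ⊢
      rw [sum_congr rfl fun j hj => by rw [hy j (ne_of_mem_erase hj)]]
      omega
    rcases lt_or_gt_of_ne (by simpa using hi : x i ≠ 0) with hneg | hpos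
    · have hy := hsum (x + Pi.single i 1) (by simp; omega) (fun j hj => by simp [hj])
      have h1 := ih _ (by omega) hy
      have h2 := h i x hx
      rw [diff_apply] at h2
      have h3 := norm_sub_le (f (x + Pi.single i 1)) (f (x + Pi.single i 1) - f x)
      rw [sub_sub_cancel] at h3
      push_cast
      linarith
    · have hy := hsum (x - Pi.single i 1) (by simp; omega) (fun j hj => by simp [hj])
      have h1 := ih _ (by omega) hy
      have h2 := h i (x - Pi.single i 1) (by omega)
      rw [diff_apply, sub_add_cancel] at h2
      have h3 := norm_add_le (f (x - Pi.single i 1)) (f x - f (x - Pi.single i 1))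
      rw [add_sub_cancel] at h3
      push_cast
      linarith

lemma exists_growth_of_mem_polyLT {k : ℕ} {f : (Fin d → ℤ) → ℂ} (hf : f ∈ polyLT d (k + 1)) :
    ∃ C : ℝ, 0 ≤ C ∧ ∀ x, ‖f x‖ ≤ C * (1 + ((∑ i, (x i).natAbs : ℕ) : ℝ)) ^ k := by
  induction k generalizing f with
  | zero =>
    refine ⟨‖f 0‖, norm_nonneg _, fun x => ?_⟩
    have := norm_le_of_norm_diff_le (f := f) (B := 0)
      (fun i y _ => by simp [mem_polyLT_zero.1 (mem_polyLT_succ.1 hf i)]) x le_rfl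
    simpa using this
  | succ k ih =>
    choose C hC h using fun i => ih (mem_polyLT_succ.1 hf i)
    refine ⟨‖f 0‖ + ∑ i, C i, add_nonneg (norm_nonneg _) (sum_nonneg fun i _ => hC i),
      fun x => ?_⟩
    set s : ℝ := ((∑ i, (x i).natAbs : ℕ) : ℝ) with hs
    have hs0 : 0 ≤ s := by positivity
    have hC0 : 0 ≤ ∑ i, C i := sum_nonneg fun i _ => hC i
    have key := norm_le_of_norm_diff_le (f := f) (B := (∑ i, C i) * (1 + s) ^ k)
      (fun i y hy => (h i y).trans (by
        have : C i ≤ ∑ i, C i := single_le_sum (fun i _ => hC i) (mem_univ i)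
        have : ((∑ j, (y j).natAbs : ℕ) : ℝ) ≤ s := Nat.cast_le.2 hy
        gcongr)) x le_rfl
    rw [← hs] at key
    have h1 : 1 ≤ (1 + s) ^ (k + 1) := one_le_pow₀ (by linarith)
    calc ‖f x‖ ≤ ‖f 0‖ * 1 + (∑ i, C i) * (s * (1 + s) ^ k) := by linarith
      _ ≤ ‖f 0‖ * (1 + s) ^ (k + 1) + (∑ i, C i) * ((1 + s) * (1 + s) ^ k) := by
        gcongr
        linarith
      _ = _ := by ring

lemma finrank_harmonic_add (hd : 1 ≤ d) (k : ℕ) :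
    (d + k - 2).choose d + Module.finrank ℂ (polyLT d (k + 1) ⊓ (lap d).ker : Submodule ℂ _) =
      (d + k).choose d := by
  rw [← finrank_polyLT_succ, ← finrank_map_add_finrank_inf_ker (polyLT d (k + 1)) (lap d),
    map_lap_polyLT ⟨0, hd⟩]
  congr 1
  match k with
  | 0 | 1 => rw [Nat.choose_eq_zero_of_lt (by omega)]; exact (finrank_polyLT_zero d).symm
  | k + 2 => exact (finrank_polyLT_succ d k).symm

end Lattice

/-- Heilbronn's theorem: the space of harmonic functions on `ℤ^d` (with respect to the
simple random walk on the standard generators) of polynomial growth of degree at most `k`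
has dimension `C(d+k, d) - C(d+k-2, d)`. `H` is the subspace of such functions. -/
theorem heilbronn_dim (d k : ℕ) (hd : 1 ≤ d)
    (H : Submodule ℂ ((Fin d → ℤ) → ℂ))
    (hH : ∀ f : (Fin d → ℤ) → ℂ, f ∈ H ↔
      ((∀ x : Fin d → ℤ, f x = (1 / (2 * (d : ℂ))) *
          ∑ i : Fin d, (f (x + Pi.single i 1) + f (x - Pi.single i 1))) ∧
        ∃ C : ℝ, ∀ x : Fin d → ℤ,
          ‖f x‖ ≤ C * (1 + ((∑ i : Fin d, (x i).natAbs : ℕ) : ℝ)) ^ k)) :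
    Module.finrank ℂ H = Nat.choose (d + k) d - Nat.choose (d + k - 2) d := by
  have hd0 : (2 * d : ℂ) ≠ 0 := by
    have : d ≠ 0 := by omega
    simpa
  have hHeq : H = Lattice.polyLT d (k + 1) ⊓ (Lattice.lap d).ker := by
    ext f
    have hharm : (∀ x : Fin d → ℤ, f x = (1 / (2 * (d : ℂ))) *
        ∑ i : Fin d, (f (x + Pi.single i 1) + f (x - Pi.single i 1))) ↔ Lattice.lap d f = 0 := by
      rw [funext_iff]
      refine forall_congr' fun x => ?_
      rw [Lattice.lap_apply, Pi.zero_apply, sub_eq_zero, one_div, eq_inv_mul_iff_mul_eq₀ hd0,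
        eq_comm]
    rw [hH, hharm, Submodule.mem_inf, LinearMap.mem_ker]
    constructor
    · rintro ⟨hf, C, hC⟩
      exact ⟨Lattice.mem_polyLT_of_growth hd hf hC, hf⟩
    · rintro ⟨hf, hf0⟩
      obtain ⟨C, -, hC⟩ := Lattice.exists_growth_of_mem_polyLT hf
      exact ⟨hf0, C, hC⟩
  have := Lattice.finrank_harmonic_add hd k
  rw [hHeq]
  omega
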